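/- For every l ∈ ℤ and every integer m ≥ 0, the double coset set R(ℚ_p)·h(l,m)·K_p is the disjoint union over t ∈ T_m of the sets R(ℚ_p)·h(l,m)·t·I_p; that is, every element of R(ℚ_p)·h(l,m)·K_p lies in R(ℚ_p)·h(l,m)·t·I_p for exactly one t ∈ T_m. -/

import Mathlib

open Matrix

noncomputable section

variable (p : ℕ) [Fact p.Prime]

/-- The 4×4 symplectic similitude matrix `J`. -/
def Jmat : Matrix (Fin 4) (Fin 4) ℚ_[p] :=
  !![0,0,1,0; 0,0,0,1; -1,0,0,0; 0,-1,0,0]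

/-- `GSp₄(ℚ_p)`. -/
def GSp4 : Set (Matrix (Fin 4) (Fin 4) ℚ_[p]) :=
  {g | IsUnit g.det ∧ ∃ μ : ℚ_[p]ˣ, gᵀ * Jmat p * g = (μ : ℚ_[p]) • Jmat p}

/-- `K_p = GSp₄(ℤ_p)`, viewed inside `GSp₄(ℚ_p)`. -/
def Kp : Set (Matrix (Fin 4) (Fin 4) ℚ_[p]) :=
  {g | g ∈ GSp4 p ∧ (∀ i j, ‖g i j‖ ≤ 1) ∧ ‖g.det‖ = 1}

/-- The Iwahori subgroup `I_p`: elements of `K_p` whose reduction mod `p` has zero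
entries at positions (1,2), (3,1), (3,2), (4,1), (4,2), (4,3) (0-indexed below). -/
def Ip : Set (Matrix (Fin 4) (Fin 4) ℚ_[p]) :=
  {g | g ∈ Kp p ∧ ‖g 0 1‖ < 1 ∧ ‖g 2 0‖ < 1 ∧ ‖g 2 1‖ < 1 ∧
      ‖g 3 0‖ < 1 ∧ ‖g 3 1‖ < 1 ∧ ‖g 3 2‖ < 1}

/-- The matrix `U_x` for `x = (n,q,r)`. -/
def Umat (n q r : ℚ_[p]) : Matrix (Fin 4) (Fin 4) ℚ_[p] :=
  !![1,0,n,q; 0,1,q,r; 0,0,1,0; 0,0,0,1]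

/-- The matrix `Z_y` for `y ∈ ℤ_p`. -/
def Zmat (y : ℚ_[p]) : Matrix (Fin 4) (Fin 4) ℚ_[p] :=
  !![1,y,0,0; 0,1,0,0; 0,0,1,0; 0,0,-y,1]

/-- The matrix `Z_∞`. -/
def Zinf : Matrix (Fin 4) (Fin 4) ℚ_[p] :=
  !![0,1,0,0; 1,0,0,0; 0,0,0,1; 0,0,1,0]

/-- Assemble a 4×4 matrix from 2×2 blocks. -/
def blk (A B C D : Matrix (Fin 2) (Fin 2) ℚ_[p]) : Matrix (Fin 4) (Fin 4) ℚ_[p] :=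
  Matrix.reindex finSumFinEquiv finSumFinEquiv (fromBlocks A B C D)

variable (a b c : ℚ_[p])

/-- The matrix `S = (a, b/2; b/2, c)`. -/
def Smat : Matrix (Fin 2) (Fin 2) ℚ_[p] := !![a, b/2; b/2, c]

/-- The matrix `ξ = (b/2, c; −a, −b/2)`. -/
def xiS : Matrix (Fin 2) (Fin 2) ℚ_[p] := !![b/2, c; -a, -b/2]

/-- The torus `T(ℚ_p) = {g ∈ GL₂(ℚ_p) : gᵀSg = det(g)·S}`. -/
def Tgrp : Set (Matrix (Fin 2) (Fin 2) ℚ_[p]) :=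
  {g | IsUnit g.det ∧ gᵀ * Smat p a b c * g = g.det • Smat p a b c}

/-- The embedding `g ↦ diag(g, det(g)·(g⁻¹)ᵀ)` of `GL₂` into `GSp₄`. -/
def emb (g : Matrix (Fin 2) (Fin 2) ℚ_[p]) : Matrix (Fin 4) (Fin 4) ℚ_[p] :=
  blk p g 0 0 (g.det • (g⁻¹)ᵀ)

/-- The unipotent group `U(ℚ_p)`. -/
def Ugrp : Set (Matrix (Fin 4) (Fin 4) ℚ_[p]) :=
  {u | ∃ X : Matrix (Fin 2) (Fin 2) ℚ_[p], Xᵀ = X ∧ u = blk p 1 X 0 1}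

/-- The Bessel group `R(ℚ_p) = T(ℚ_p)·U(ℚ_p)` inside `GSp₄(ℚ_p)`. -/
def Rgrp : Set (Matrix (Fin 4) (Fin 4) ℚ_[p]) :=
  {r | ∃ t ∈ Tgrp p a b c, ∃ u ∈ Ugrp p, r = emb p t * u}

/-- `h(l,m) = diag(p^{2m+l}, p^{m+l}, 1, p^m)`. -/
def hmat (l : ℤ) (m : ℕ) : Matrix (Fin 4) (Fin 4) ℚ_[p] :=
  diagonal ![(p : ℚ_[p]) ^ (2 * (m : ℤ) + l), (p : ℚ_[p]) ^ ((m : ℤ) + l), 1, (p : ℚ_[p]) ^ (m : ℤ)]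

/-- `(l,m)`-equivalence: `f ~ g` iff `r·h(l,m)·f·k = h(l,m)·g` for some
`r ∈ R(ℚ_p)`, `k ∈ I_p`. -/
def LMEquiv (l : ℤ) (m : ℕ) (f g : Matrix (Fin 4) (Fin 4) ℚ_[p]) : Prop :=
  ∃ r ∈ Rgrp p a b c, ∃ k ∈ Ip p, r * hmat p l m * f * k = hmat p l m * g

/-- `t₁ = B_{(1,0,0)}^0`. -/
def t1 : Matrix (Fin 4) (Fin 4) ℚ_[p] := Jmat p * Umat p 1 0 0 * Jmat p * Zmat p 0
/-- `t₂ = B_{(1,0,0)}^∞`. -/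
def t2 : Matrix (Fin 4) (Fin 4) ℚ_[p] := Jmat p * Umat p 1 0 0 * Jmat p * Zinf p
/-- `t₃ = B_{(0,0,1)}^0`. -/
def t3 : Matrix (Fin 4) (Fin 4) ℚ_[p] := Jmat p * Umat p 0 0 1 * Jmat p * Zmat p 0
/-- `t₄ = B_{(0,0,1)}^∞`. -/
def t4 : Matrix (Fin 4) (Fin 4) ℚ_[p] := Jmat p * Umat p 0 0 1 * Jmat p * Zinf p
/-- `t₅ = B_{(0,0,0)}^0`. -/
def t5 : Matrix (Fin 4) (Fin 4) ℚ_[p] := Jmat p * Umat p 0 0 0 * Jmat p * Zmat p 0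
/-- `t₆ = B_{(0,0,0)}^∞`. -/
def t6 : Matrix (Fin 4) (Fin 4) ℚ_[p] := Jmat p * Umat p 0 0 0 * Jmat p * Zinf p
/-- `t₇ = A_{(0,0,0)}^0`. -/
def t7 : Matrix (Fin 4) (Fin 4) ℚ_[p] := Umat p 0 0 0 * Jmat p * Zmat p 0
/-- `t₈ = A_{(0,0,0)}^∞`. -/
def t8 : Matrix (Fin 4) (Fin 4) ℚ_[p] := Umat p 0 0 0 * Jmat p * Zinf p

/-- `T_m`: `{t₁,…,t₈}` if `m > 0`, and `{t₁, t₂, t₅, t₇}` if `m = 0`. -/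
def TsetM (m : ℕ) : Set (Matrix (Fin 4) (Fin 4) ℚ_[p]) :=
  if m = 0 then {t1 p, t2 p, t5 p, t7 p}
  else {t1 p, t2 p, t3 p, t4 p, t5 p, t6 p, t7 p, t8 p}

section CommRing

variable {R : Type*} [CommRing R]

/-- The standard symplectic form over a commutative ring. -/
def sympJ (R : Type*) [CommRing R] : Matrix (Fin 4) (Fin 4) R :=
  !![0,0,1,0; 0,0,0,1; -1,0,0,0; 0,-1,0,0]

/-- `g` is a symplectic similitude with multiplier `μ`. -/
def IsSim (g : Matrix (Fin 4) (Fin 4) R) (μ : R) : Prop :=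
  gᵀ * sympJ R * g = μ • sympJ R

/-- The vanishing pattern defining the Iwahori subgroup. -/
def IwahoriShape (g : Matrix (Fin 4) (Fin 4) R) : Prop :=
  g 0 1 = 0 ∧ g 2 0 = 0 ∧ g 2 1 = 0 ∧ g 3 0 = 0 ∧ g 3 1 = 0 ∧ g 3 2 = 0

/-- Elements of the unipotent radical of the Siegel parabolic. -/
def siegelU (n q r : R) : Matrix (Fin 4) (Fin 4) R :=
  !![1,0,n,q; 0,1,q,r; 0,0,1,0; 0,0,0,1]

/-- The norm form of the Bessel torus of conductor `e`. -/
def torusNorm (a b c e u y : R) : R := u ^ 2 + e * b * u * y + a * c * e ^ 2 * y ^ 2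

/-- Elements of the Bessel torus of conductor `e`, conjugated to be upper triangular modulo `e`. -/
def torus (a b c e u y : R) : Matrix (Fin 4) (Fin 4) R :=
  !![u + e * y * b, y * c, 0, 0; -(y * a * e ^ 2), u, 0, 0;
    0, 0, u, y * a * e ^ 2; 0, 0, -(y * c), u + e * y * b]

/-- The representatives `t₁, …, t₈` over a commutative ring. -/
def cellRep (R : Type*) [CommRing R] : Fin 8 → Matrix (Fin 4) (Fin 4) R :=
  ![!![-1,0,0,0; 0,-1,0,0; 1,0,-1,0; 0,0,0,-1],
    !![0,-1,0,0; -1,0,0,0; 0,1,0,-1; 0,0,-1,0],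
    !![-1,0,0,0; 0,-1,0,0; 0,0,-1,0; 0,1,0,-1],
    !![0,-1,0,0; -1,0,0,0; 0,0,0,-1; 1,0,-1,0],
    !![-1,0,0,0; 0,-1,0,0; 0,0,-1,0; 0,0,0,-1],
    !![0,-1,0,0; -1,0,0,0; 0,0,0,-1; 0,0,-1,0],
    !![0,0,1,0; 0,0,0,1; -1,0,0,0; 0,-1,0,0],
    !![0,0,0,1; 0,0,1,0; 0,-1,0,0; -1,0,0,0]]

/-- The inverses of the representatives `t₁, …, t₈`. -/
def cellRepInv (R : Type*) [CommRing R] : Fin 8 → Matrix (Fin 4) (Fin 4) R :=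
  ![!![-1,0,0,0; 0,-1,0,0; -1,0,-1,0; 0,0,0,-1],
    !![0,-1,0,0; -1,0,0,0; 0,0,0,-1; -1,0,-1,0],
    !![-1,0,0,0; 0,-1,0,0; 0,0,-1,0; 0,-1,0,-1],
    !![0,-1,0,0; -1,0,0,0; 0,-1,0,-1; 0,0,-1,0],
    !![-1,0,0,0; 0,-1,0,0; 0,0,-1,0; 0,0,0,-1],
    !![0,-1,0,0; -1,0,0,0; 0,0,0,-1; 0,0,-1,0],
    !![0,0,-1,0; 0,0,0,-1; 1,0,0,0; 0,1,0,0],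
    !![0,0,0,-1; 0,0,-1,0; 0,1,0,0; 1,0,0,0]]

lemma cellRep_mul_cellRepInv (j : Fin 8) : cellRep R j * cellRepInv R j = 1 := by
  fin_cases j <;> ext i k <;> fin_cases i <;> fin_cases k <;>
    simp [cellRep, cellRepInv, Matrix.mul_apply, Fin.sum_univ_four]

lemma cellRepInv_mul_cellRep (j : Fin 8) : cellRepInv R j * cellRep R j = 1 :=
  mul_eq_one_comm.mp (cellRep_mul_cellRepInv j)

lemma isSim_cellRep (j : Fin 8) : IsSim (cellRep R j) 1 := by
  unfold IsSim
  fin_cases j <;> ext i k <;> fin_cases i <;> fin_cases k <;>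
    simp [cellRep, sympJ, Matrix.mul_apply, Fin.sum_univ_four]

lemma isSim_cellRepInv (j : Fin 8) : IsSim (cellRepInv R j) 1 := by
  unfold IsSim
  fin_cases j <;> ext i k <;> fin_cases i <;> fin_cases k <;>
    simp [cellRepInv, sympJ, Matrix.mul_apply, Fin.sum_univ_four]

lemma map_cellRep {S : Type*} [CommRing S] (f : R →+* S) (j : Fin 8) :
    (cellRep R j).map f = cellRep S j := by
  fin_cases j <;> ext i k <;> fin_cases i <;> fin_cases k <;> simp [cellRep]

lemma map_cellRepInv {S : Type*} [CommRing S] (f : R →+* S) (j : Fin 8) :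
    (cellRepInv R j).map f = cellRepInv S j := by
  fin_cases j <;> ext i k <;> fin_cases i <;> fin_cases k <;> simp [cellRepInv]

lemma map_sympJ {S : Type*} [CommRing S] (f : R →+* S) : (sympJ R).map f = sympJ S := by
  ext i k; fin_cases i <;> fin_cases k <;> simp [sympJ]

lemma map_siegelU {S : Type*} [CommRing S] (f : R →+* S) (n q r : R) :
    (siegelU n q r).map f = siegelU (f n) (f q) (f r) := by
  ext i k; fin_cases i <;> fin_cases k <;> simp [siegelU]

lemma map_torus {S : Type*} [CommRing S] (f : R →+* S) (a b c e u y : R) :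
    (torus a b c e u y).map f = torus (f a) (f b) (f c) (f e) (f u) (f y) := by
  ext i k; fin_cases i <;> fin_cases k <;> simp [torus]

lemma isSim_siegelU (n q r : R) : IsSim (siegelU n q r) 1 := by
  unfold IsSim
  ext i k; fin_cases i <;> fin_cases k <;>
    simp [siegelU, sympJ, Matrix.mul_apply, Fin.sum_univ_four]

lemma isSim_torus (a b c e u y : R) :
    IsSim (torus a b c e u y) (torusNorm a b c e u y) := by
  unfold IsSim
  ext i k; fin_cases i <;> fin_cases k <;>
    simp [torus, torusNorm, sympJ, Matrix.mul_apply, Fin.sum_univ_four] <;> ring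

lemma IsSim.mul {g g' : Matrix (Fin 4) (Fin 4) R} {μ μ' : R} (h : IsSim g μ)
    (h' : IsSim g' μ') : IsSim (g * g') (μ * μ') := by
  unfold IsSim at *
  calc (g * g')ᵀ * sympJ R * (g * g') = g'ᵀ * (gᵀ * sympJ R * g) * g' := by
        simp only [Matrix.transpose_mul, Matrix.mul_assoc]
    _ = _ := by rw [h, Matrix.mul_smul, Matrix.smul_mul, h', smul_smul]

lemma IsSim.map {S : Type*} [CommRing S] {g : Matrix (Fin 4) (Fin 4) R} {μ : R}
    (h : IsSim g μ) (f : R →+* S) : IsSim (g.map f) (f μ) := by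
  unfold IsSim at *
  have := congrArg (fun M => M.map f) h
  simpa [Matrix.map_mul, map_sympJ, Matrix.transpose_map, Matrix.map_smul'] using this

lemma det_sympJ : (sympJ R).det = 1 := by
  simp [sympJ, Matrix.det_succ_row_zero, Fin.sum_univ_succ, Fin.succAbove]

lemma IsSim.det_sq {g : Matrix (Fin 4) (Fin 4) R} {μ : R} (h : IsSim g μ) :
    g.det ^ 2 = μ ^ 4 := by
  have := congrArg Matrix.det h
  simp only [Matrix.det_mul, Matrix.det_transpose, det_sympJ, Matrix.det_smul,
    Fintype.card_fin] at this
  linear_combination this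

/-- The symplectic adjoint. -/
def symAdj (g : Matrix (Fin 4) (Fin 4) R) : Matrix (Fin 4) (Fin 4) R :=
  -(sympJ R * gᵀ * sympJ R)

lemma sympJ_mul_sympJ : sympJ R * sympJ R = -1 := by
  ext i k; fin_cases i <;> fin_cases k <;> simp [sympJ, Matrix.mul_apply, Fin.sum_univ_four]

lemma IsSim.symAdj_mul {g : Matrix (Fin 4) (Fin 4) R} {μ : R} (h : IsSim g μ) :
    symAdj g * g = μ • (1 : Matrix (Fin 4) (Fin 4) R) := by
  unfold IsSim at h
  unfold symAdj
  rw [neg_mul, Matrix.mul_assoc, Matrix.mul_assoc, ← Matrix.mul_assoc gᵀ, h, Matrix.mul_smul,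
    sympJ_mul_sympJ, smul_neg, neg_neg]

lemma IsSim.symAdj {g : Matrix (Fin 4) (Fin 4) R} {μ : R} (h : IsSim g μ) (hμ : IsUnit μ) :
    IsSim (symAdj g) μ := by
  obtain ⟨v, rfl⟩ := hμ
  have h1 : g * ((↑v⁻¹ : R) • _root_.symAdj g) = 1 := by
    rw [mul_eq_one_comm, Matrix.smul_mul, h.symAdj_mul, smul_smul]; simp
  have h2 : g * _root_.symAdj g = (v : R) • (1 : Matrix (Fin 4) (Fin 4) R) := by
    have := congrArg (fun M => (v : R) • M) h1
    simpa [Matrix.mul_smul, smul_smul] using this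
  have hJ : (sympJ R)ᵀ = -sympJ R := by
    ext i k; fin_cases i <;> fin_cases k <;> simp [sympJ]
  unfold IsSim
  have h3 : (_root_.symAdj g)ᵀ = -(sympJ R * g * sympJ R) := by
    simp [_root_.symAdj, Matrix.transpose_mul, hJ, Matrix.mul_assoc]
  rw [h3]
  calc -(sympJ R * g * sympJ R) * sympJ R * _root_.symAdj g
      = -(sympJ R * g * (sympJ R * sympJ R) * _root_.symAdj g) := by
        simp only [Matrix.mul_assoc, Matrix.neg_mul]
    _ = sympJ R * (g * _root_.symAdj g) := by
        rw [sympJ_mul_sympJ]; simp [Matrix.mul_assoc]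
    _ = _ := by rw [h2]; simp

lemma IwahoriShape.mul {g g' : Matrix (Fin 4) (Fin 4) R} (h : IwahoriShape g)
    (h' : IwahoriShape g') : IwahoriShape (g * g') := by
  obtain ⟨h1, h2, h3, h4, h5, h6⟩ := h
  obtain ⟨k1, k2, k3, k4, k5, k6⟩ := h'
  simp [IwahoriShape, Matrix.mul_apply, Fin.sum_univ_four, *]

lemma IwahoriShape.symAdj {g : Matrix (Fin 4) (Fin 4) R} (h : IwahoriShape g) :
    IwahoriShape (symAdj g) := by
  obtain ⟨h1, h2, h3, h4, h5, h6⟩ := h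
  simp only [IwahoriShape, _root_.symAdj, Matrix.neg_apply, Matrix.mul_apply, Fin.sum_univ_four,
    Matrix.transpose_apply]
  simp [sympJ, *]

lemma IwahoriShape.smul {g : Matrix (Fin 4) (Fin 4) R} (h : IwahoriShape g) (x : R) :
    IwahoriShape (x • g) := by
  obtain ⟨h1, h2, h3, h4, h5, h6⟩ := h
  simp [IwahoriShape, *]

end CommRing

section Field

variable {F : Type*} [Field F]

lemma IsSim.entries {R : Type*} [CommRing R] {g : Matrix (Fin 4) (Fin 4) R} {μ : R}
    (h : IsSim g μ) (i j : Fin 4) :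
    g 0 i * g 2 j + g 1 i * g 3 j - g 2 i * g 0 j - g 3 i * g 1 j = μ * sympJ R i j := by
  have := congrFun (congrFun h i) j
  simp only [Matrix.mul_apply, Fin.sum_univ_four, Matrix.transpose_apply, Matrix.smul_apply,
    smul_eq_mul] at this
  rw [← this]
  simp [sympJ]
  ring

/-- For symplectic similitudes over a field the last Iwahori condition follows from the others. -/
lemma IwahoriShape.of_isSim {g : Matrix (Fin 4) (Fin 4) F} {μ : F} (h : IsSim g μ) (hμ : μ ≠ 0)
    (h01 : g 0 1 = 0) (h20 : g 2 0 = 0) (h21 : g 2 1 = 0) (h30 : g 3 0 = 0) (h31 : g 3 1 = 0) :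
    IwahoriShape g := by
  refine ⟨h01, h20, h21, h30, h31, ?_⟩
  have e1 := h.entries 1 2
  have e2 := h.entries 1 3
  simp [sympJ, h01, h21, h31] at e1 e2
  grind

/-- Normal form, modulo the unipotent radical, of the elements of the `j`-th cell. -/
def CellCond (g : Matrix (Fin 4) (Fin 4) F) : Fin 8 → Prop :=
  ![g 3 0 = 0 ∧ g 3 1 = 0 ∧ g 2 1 = 0 ∧ g 2 0 ≠ 0,
    g 3 0 = 0 ∧ g 3 1 = 0 ∧ g 2 1 ≠ 0,
    g 2 0 = 0 ∧ g 2 1 = 0 ∧ g 3 1 ≠ 0,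
    g 2 0 = 0 ∧ g 2 1 = 0 ∧ g 3 1 = 0 ∧ g 3 0 ≠ 0,
    g 2 0 = 0 ∧ g 2 1 = 0 ∧ g 3 0 = 0 ∧ g 3 1 = 0 ∧ g 0 1 = 0,
    g 2 0 = 0 ∧ g 2 1 = 0 ∧ g 3 0 = 0 ∧ g 3 1 = 0 ∧ g 1 1 = 0,
    g 2 1 = 0 ∧ g 2 0 * g 3 1 - g 2 1 * g 3 0 ≠ 0,
    g 3 1 = 0 ∧ g 2 0 * g 3 1 - g 2 1 * g 3 0 ≠ 0]

lemma exists_unipotent_iwahori {g : Matrix (Fin 4) (Fin 4) F} {μ : F} (h : IsSim g μ)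
    (hμ : μ ≠ 0) (j : Fin 8) (hj : CellCond g j) :
    ∃ n q r : F, IwahoriShape (cellRepInv F j * (siegelU n q r * g)) := by
  have key := fun n q r (j : Fin 8) =>
    IwahoriShape.of_isSim ((isSim_cellRepInv j).mul ((isSim_siegelU n q r).mul h))
      (by simpa using hμ)
  have e := h.entries 0 1
  have e0 : sympJ F 0 1 = 0 := by simp [sympJ]
  rw [e0] at e
  fin_cases j
  · obtain ⟨h1, h2, h3, h4⟩ := hj
    refine ⟨-1 - g 0 0 / g 2 0, 0, 0, key _ _ _ _ ?_ ?_ ?_ ?_ ?_⟩ <;>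
      simp only [Matrix.mul_apply, Fin.sum_univ_four] <;>
      simp [cellRepInv, siegelU, h1, h2, h3] <;> grind
  · obtain ⟨h1, h2, h3⟩ := hj
    refine ⟨-1 - g 0 1 / g 2 1, - g 1 1 / g 2 1, 0, key _ _ _ _ ?_ ?_ ?_ ?_ ?_⟩ <;>
      simp only [Matrix.mul_apply, Fin.sum_univ_four] <;>
      simp [cellRepInv, siegelU, h1, h2] <;> grind
  · obtain ⟨h1, h2, h3⟩ := hj
    refine ⟨0, - g 0 1 / g 3 1, -1 - g 1 1 / g 3 1, key _ _ _ _ ?_ ?_ ?_ ?_ ?_⟩ <;>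
      simp only [Matrix.mul_apply, Fin.sum_univ_four] <;>
      simp [cellRepInv, siegelU, h1, h2] <;> grind
  · obtain ⟨h1, h2, h3, h4⟩ := hj
    refine ⟨0, 0, -1 - g 1 0 / g 3 0, key _ _ _ _ ?_ ?_ ?_ ?_ ?_⟩ <;>
      simp only [Matrix.mul_apply, Fin.sum_univ_four] <;>
      simp [cellRepInv, siegelU, h1, h2, h3] <;> grind
  · obtain ⟨h1, h2, h3, h4, h5⟩ := hj
    refine ⟨0, 0, 0, key _ _ _ _ ?_ ?_ ?_ ?_ ?_⟩ <;>
      simp only [Matrix.mul_apply, Fin.sum_univ_four] <;>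
      simp [cellRepInv, siegelU, h1, h2, h3, h4, h5]
  · obtain ⟨h1, h2, h3, h4, h5⟩ := hj
    refine ⟨0, 0, 0, key _ _ _ _ ?_ ?_ ?_ ?_ ?_⟩ <;>
      simp only [Matrix.mul_apply, Fin.sum_univ_four] <;>
      simp [cellRepInv, siegelU, h1, h2, h3, h4, h5]
  · obtain ⟨h1, h2⟩ := hj
    refine ⟨-(g 0 0 * g 3 1 - g 0 1 * g 3 0) / (g 2 0 * g 3 1 - g 2 1 * g 3 0),
      -(g 0 1 * g 2 0 - g 0 0 * g 2 1) / (g 2 0 * g 3 1 - g 2 1 * g 3 0),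
      -(g 1 1 * g 2 0 - g 1 0 * g 2 1) / (g 2 0 * g 3 1 - g 2 1 * g 3 0),
      key _ _ _ _ ?_ ?_ ?_ ?_ ?_⟩ <;>
      simp only [Matrix.mul_apply, Fin.sum_univ_four] <;>
      simp [cellRepInv, siegelU] <;> grind
  · obtain ⟨h1, h2⟩ := hj
    refine ⟨-(g 0 0 * g 3 1 - g 0 1 * g 3 0) / (g 2 0 * g 3 1 - g 2 1 * g 3 0),
      -(g 0 1 * g 2 0 - g 0 0 * g 2 1) / (g 2 0 * g 3 1 - g 2 1 * g 3 0),
      -(g 1 1 * g 2 0 - g 1 0 * g 2 1) / (g 2 0 * g 3 1 - g 2 1 * g 3 0),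
      key _ _ _ _ ?_ ?_ ?_ ?_ ?_⟩ <;>
      simp only [Matrix.mul_apply, Fin.sum_univ_four] <;>
      simp [cellRepInv, siegelU] <;> grind

/-- When the conductor vanishes in `F`, every similitude is moved to one of eight cells. -/
lemma exists_torus_cellCond_zero {a b c : F} (hc : c ≠ 0) (g : Matrix (Fin 4) (Fin 4) F) :
    ∃ (j : Fin 8) (u y : F), torusNorm a b c 0 u y ≠ 0 ∧
      CellCond (torus a b c 0 u y * g) j := by
  have key : ∀ s : F, ∃ y : F, y * c = s := fun s => ⟨s / c, by field_simp⟩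
  suffices H : ∃ (j : Fin 8) (s : F), ∀ y : F, y * c = s →
      CellCond (torus a b c 0 1 y * g) j by
    obtain ⟨j, s, H⟩ := H
    obtain ⟨y, hy⟩ := key s
    exact ⟨j, 1, y, by simp [torusNorm], H y hy⟩
  by_cases h21 : g 2 1 = 0
  · by_cases h20 : g 2 0 = 0
    · by_cases h31 : g 3 1 = 0
      · by_cases h30 : g 3 0 = 0
        · by_cases h11 : g 1 1 = 0
          · refine ⟨5, 0, fun y hy => ?_⟩
            simp only [CellCond, Matrix.mul_apply, Fin.sum_univ_four]
            simp [torus, *]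
          · refine ⟨4, -g 0 1 / g 1 1, fun y hy => ?_⟩
            simp only [CellCond, Matrix.mul_apply, Fin.sum_univ_four]
            simp [torus, *]
        · refine ⟨3, 0, fun y hy => ?_⟩
          simp only [CellCond, Matrix.mul_apply, Fin.sum_univ_four]
          simp [torus, *]
      · refine ⟨2, 0, fun y hy => ?_⟩
        simp only [CellCond, Matrix.mul_apply, Fin.sum_univ_four]
        simp [torus, *]
    · by_cases h31 : g 3 1 = 0
      · refine ⟨0, g 3 0 / g 2 0, fun y hy => ?_⟩
        simp only [CellCond, Matrix.mul_apply, Fin.sum_univ_four]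
        simp [torus, *]
      · refine ⟨6, 0, fun y hy => ?_⟩
        simp only [CellCond, Matrix.mul_apply, Fin.sum_univ_four]
        simp [torus, *]
  · by_cases hd : g 2 0 * g 3 1 - g 2 1 * g 3 0 = 0
    · refine ⟨1, g 3 1 / g 2 1, fun y hy => ?_⟩
      simp only [CellCond, Matrix.mul_apply, Fin.sum_univ_four]
      simp [torus, *]
      grind
    · refine ⟨7, g 3 1 / g 2 1, fun y hy => ?_⟩
      simp only [CellCond, Matrix.mul_apply, Fin.sum_univ_four]
      simp [torus, *]
      grind

/-- When the torus is anisotropic over `F`, every similitude is moved to one of four cells. -/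
lemma exists_torus_cellCond_one {a b c : F}
    (hS : ∀ x y : F, a * x ^ 2 + b * x * y + c * y ^ 2 = 0 → x = 0 ∧ y = 0)
    {g : Matrix (Fin 4) (Fin 4) F} {μ : F} (h : IsSim g μ) (hμ : μ ≠ 0) :
    ∃ j ∈ ({0, 1, 4, 6} : Set (Fin 8)), ∃ u y : F, torusNorm a b c 1 u y ≠ 0 ∧
      CellCond (torus a b c 1 u y * g) j := by
  have ha : a ≠ 0 := fun h0 => one_ne_zero (hS 1 0 (by simp [h0])).1
  have hc : c ≠ 0 := fun h0 => one_ne_zero (hS 0 1 (by simp [h0])).2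
  have norm_ne : ∀ x z : F, x ≠ 0 ∨ z ≠ 0 → torusNorm a b c 1 (c * x - b * z) z ≠ 0 := by
    intro x z hxz h0
    have := hS z (-x) (by
      refine (mul_eq_zero.mp (?_ : c * _ = 0)).resolve_left hc
      rw [← h0, torusNorm]; ring)
    grind
  have norm_ne' : ∀ x z : F, x ≠ 0 ∨ z ≠ 0 → torusNorm a b c 1 (a * x) (-z) ≠ 0 := by
    intro x z hxz h0
    have := hS x (-z) (by
      refine (mul_eq_zero.mp (?_ : a * _ = 0)).resolve_left ha
      rw [← h0, torusNorm]; ring)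
    grind
  by_cases hd : g 2 0 * g 3 1 - g 2 1 * g 3 0 = 0
  · by_cases h1 : g 2 1 = 0 ∧ g 3 1 = 0
    · by_cases h0 : g 2 0 = 0 ∧ g 3 0 = 0
      · have hne : g 1 1 ≠ 0 ∨ g 0 1 ≠ 0 := by
          by_contra! hh
          have := h.entries 1 3
          simp [h1, hh, sympJ] at this
          exact hμ this.symm
        refine ⟨4, by simp, c * g 1 1 - b * (-g 0 1), -g 0 1, norm_ne _ _ (by simpa using hne), ?_⟩
        simp only [CellCond, Matrix.mul_apply, Fin.sum_univ_four]
        simp [torus, h1, h0]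
        grind
      · refine ⟨0, by simp, c * g 2 0 - b * g 3 0, g 3 0, norm_ne _ _ (by tauto), ?_⟩
        have h2 := hS (g 3 0) (-g 2 0)
        simp only [CellCond, Matrix.mul_apply, Fin.sum_univ_four]
        simp [torus, h1]
        grind
    · refine ⟨1, by simp, c * g 2 1 - b * g 3 1, g 3 1, norm_ne _ _ (by tauto), ?_⟩
      have h2 := hS (g 3 1) (-g 2 1)
      simp only [CellCond, Matrix.mul_apply, Fin.sum_univ_four]
      simp [torus]
      grind
  · have hne : g 3 1 ≠ 0 ∨ g 2 1 ≠ 0 := by grind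
    have hN := norm_ne' _ _ hne
    refine ⟨6, by simp, a * g 3 1, -g 2 1, hN, ?_⟩
    unfold torusNorm at hN
    simp only [CellCond, Matrix.mul_apply, Fin.sum_univ_four]
    simp [torus]
    refine ⟨by ring, ?_⟩
    convert mul_ne_zero hN hd using 1
    ring_nf

set_option maxHeartbeats 1000000 in
lemma cell_disjoint_zero {g : Matrix (Fin 4) (Fin 4) F} {μ : F} (h : IsSim g μ) (hμ : μ ≠ 0)
    (h20 : g 2 0 = 0) (h21 : g 2 1 = 0) (h30 : g 3 0 = 0) (h31 : g 3 1 = 0) (h10 : g 1 0 = 0)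
    (j k : Fin 8) (hi : IwahoriShape (cellRepInv F k * (g * cellRep F j))) : j = k := by
  have e02 := h.entries 0 2
  have e13 := h.entries 1 3
  have e03 := h.entries 0 3
  simp [sympJ, h20, h21, h30, h31, h10] at e02 e13 e03
  have n00 : g 0 0 ≠ 0 := by grind
  have n22 : g 2 2 ≠ 0 := by grind
  have n11 : g 1 1 ≠ 0 := by grind
  have n33 : g 3 3 ≠ 0 := by grind
  have z23 : g 2 3 = 0 := by grind
  simp only [IwahoriShape, Matrix.mul_apply, Fin.sum_univ_four] at hi
  fin_cases j <;> fin_cases k <;> first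
    | rfl
    | (exfalso
       simp [cellRepInv, cellRep, h20, h21, h30, h31, h10,
         n00, n22, n11, n33, z23] at hi
       try grind)

set_option maxHeartbeats 1000000 in
lemma cell_disjoint_one {g : Matrix (Fin 4) (Fin 4) F} {μ : F} (h : IsSim g μ) (hμ : μ ≠ 0)
    (h20 : g 2 0 = 0) (h21 : g 2 1 = 0) (h30 : g 3 0 = 0) (h31 : g 3 1 = 0)
    {j k : Fin 8} (hj : j ∈ ({0, 1, 4, 6} : Set (Fin 8))) (hk : k ∈ ({0, 1, 4, 6} : Set (Fin 8)))
    (hi : IwahoriShape (cellRepInv F k * (g * cellRep F j))) : j = k := by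
  have e02 := h.entries 0 2
  have e13 := h.entries 1 3
  have e03 := h.entries 0 3
  have e12 := h.entries 1 2
  simp [sympJ, h20, h21, h30, h31] at e02 e13 e03 e12
  simp only [IwahoriShape, Matrix.mul_apply, Fin.sum_univ_four] at hi
  simp only [Set.mem_insert_iff, Set.mem_singleton_iff] at hj hk
  rcases hj with rfl | rfl | rfl | rfl <;> rcases hk with rfl | rfl | rfl | rfl <;> first
    | rfl
    | (exfalso
       simp [cellRepInv, cellRep, h20, h21, h30, h31] at hi
       grind)

end Field

section Bessel

variable {F : Type*} [Field F]

/-- The Bessel subgroup of conductor `e`. -/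
def IsBessel (a b c e : F) (g : Matrix (Fin 4) (Fin 4) F) : Prop :=
  ∃ u y n q r : F, torusNorm a b c e u y ≠ 0 ∧ g = torus a b c e u y * siegelU n q r

lemma torus_mul_torus (a b c e u y u' y' : F) :
    torus a b c e u y * torus a b c e u' y' =
      torus a b c e (u * u' - a * c * e ^ 2 * y * y') (u * y' + y * u' + e * b * y * y') := by
  ext i k; fin_cases i <;> fin_cases k <;> simp [torus] <;> ring

lemma torusNorm_mul (a b c e u y u' y' : F) :
    torusNorm a b c e (u * u' - a * c * e ^ 2 * y * y') (u * y' + y * u' + e * b * y * y') =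
      torusNorm a b c e u y * torusNorm a b c e u' y' := by
  unfold torusNorm; ring

lemma siegelU_mul_siegelU (n q r n' q' r' : F) :
    siegelU n q r * siegelU n' q' r' = siegelU (n + n') (q + q') (r + r') := by
  ext i k; fin_cases i <;> fin_cases k <;> simp [siegelU] <;> ring

lemma siegelU_mul_torus {a b c e u y : F} (h : torusNorm a b c e u y ≠ 0) (n q r : F) :
    ∃ n' q' r' : F, siegelU n q r * torus a b c e u y =
      torus a b c e u y * siegelU n' q' r' := by
  refine ⟨(u ^ 2 * n - 2 * u * y * c * q + y ^ 2 * c ^ 2 * r) / torusNorm a b c e u y,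
    (u * y * a * e ^ 2 * n + (u * (u + e * y * b) - y ^ 2 * a * c * e ^ 2) * q
      - y * c * (u + e * y * b) * r) / torusNorm a b c e u y,
    (y ^ 2 * a ^ 2 * e ^ 4 * n + 2 * y * a * e ^ 2 * (u + e * y * b) * q
      + (u + e * y * b) ^ 2 * r) / torusNorm a b c e u y, ?_⟩
  ext i k; fin_cases i <;> fin_cases k <;> simp [torus, siegelU] <;> field_simp <;>
    unfold torusNorm <;> ring

lemma IsBessel.mul {a b c e : F} {g g' : Matrix (Fin 4) (Fin 4) F} (h : IsBessel a b c e g)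
    (h' : IsBessel a b c e g') : IsBessel a b c e (g * g') := by
  obtain ⟨u, y, n, q, r, hN, rfl⟩ := h
  obtain ⟨u', y', n', q', r', hN', rfl⟩ := h'
  obtain ⟨n₁, q₁, r₁, h₁⟩ := siegelU_mul_torus hN' n q r
  refine ⟨u * u' - a * c * e ^ 2 * y * y', u * y' + y * u' + e * b * y * y',
    n₁ + n', q₁ + q', r₁ + r', ?_, ?_⟩
  rotate_left
  · rw [← siegelU_mul_siegelU, ← torus_mul_torus, Matrix.mul_assoc,
      ← Matrix.mul_assoc (siegelU n q r), h₁]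
    simp only [Matrix.mul_assoc]
  · rw [torusNorm_mul]
    exact mul_ne_zero hN hN'

lemma isBessel_torus {a b c e u y : F} (h : torusNorm a b c e u y ≠ 0) :
    IsBessel a b c e (torus a b c e u y) := by
  refine ⟨u, y, 0, 0, 0, h, ?_⟩
  ext i k; fin_cases i <;> fin_cases k <;> simp [torus, siegelU]

lemma isBessel_siegelU (a b c e n q r : F) : IsBessel a b c e (siegelU n q r) := by
  refine ⟨1, 0, n, q, r, by simp [torusNorm], ?_⟩
  ext i k; fin_cases i <;> fin_cases k <;> simp [torus, siegelU]

lemma IsBessel.exists_inv {a b c e : F} {g : Matrix (Fin 4) (Fin 4) F}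
    (h : IsBessel a b c e g) : ∃ g', IsBessel a b c e g' ∧ g' * g = 1 := by
  obtain ⟨u, y, n, q, r, hN, rfl⟩ := h
  have key : torus a b c e ((u + e * y * b) / torusNorm a b c e u y)
      (-y / torusNorm a b c e u y) * torus a b c e u y = 1 := by
    ext i k; fin_cases i <;> fin_cases k <;> simp [torus] <;> field_simp <;>
      unfold torusNorm <;> ring
  refine ⟨siegelU (-n) (-q) (-r) * torus a b c e ((u + e * y * b) / torusNorm a b c e u y)
      (-y / torusNorm a b c e u y), (isBessel_siegelU ..).mul (isBessel_torus ?_), ?_⟩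
  · intro h0
    have : torusNorm a b c e u y * torusNorm a b c e ((u + e * y * b) / torusNorm a b c e u y)
        (-y / torusNorm a b c e u y) = 1 := by
      generalize hM : torusNorm a b c e u y = M at *
      unfold torusNorm at *
      field_simp
      linear_combination hM
    simp [h0] at this
  · rw [Matrix.mul_assoc, ← Matrix.mul_assoc (torus a b c e _ _) (torus a b c e u y), key,
      Matrix.one_mul, siegelU_mul_siegelU]
    ext i k; fin_cases i <;> fin_cases k <;> simp [siegelU]

lemma IsBessel.entries {a b c e : F} {g : Matrix (Fin 4) (Fin 4) F} (h : IsBessel a b c e g) :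
    g 2 0 = 0 ∧ g 2 1 = 0 ∧ g 3 0 = 0 ∧ g 3 1 = 0 ∧ c * g 1 0 = -(a * e ^ 2 * g 0 1) := by
  obtain ⟨u, y, n, q, r, hN, rfl⟩ := h
  simp [torus, siegelU]
  ring

end Bessel

lemma blk_eq (A B C D : Matrix (Fin 2) (Fin 2) ℚ_[p]) :
    blk p A B C D = !![A 0 0, A 0 1, B 0 0, B 0 1; A 1 0, A 1 1, B 1 0, B 1 1;
      C 0 0, C 0 1, D 0 0, D 0 1; C 1 0, C 1 1, D 1 0, D 1 1] := by
  ext i j; fin_cases i <;> fin_cases j <;> rfl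

lemma emb_eq {g : Matrix (Fin 2) (Fin 2) ℚ_[p]} (hg : IsUnit g.det) :
    emb p g = !![g 0 0, g 0 1, 0, 0; g 1 0, g 1 1, 0, 0; 0, 0, g 1 1, -g 1 0;
      0, 0, -g 0 1, g 0 0] := by
  have : g.det • g⁻¹ = g.adjugate := by
    rw [Matrix.inv_def, smul_smul, Ring.mul_inverse_cancel _ hg, one_smul]
  rw [emb, ← Matrix.transpose_smul, this, blk_eq, Matrix.adjugate_fin_two]
  simp

variable {a b c} in
lemma mem_Tgrp_iff (ha : a ≠ 0) {g : Matrix (Fin 2) (Fin 2) ℚ_[p]} :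
    g ∈ Tgrp p a b c ↔ ∃ u y : ℚ_[p], torusNorm a b c 1 u y ≠ 0 ∧
      g = !![u + y * b, y * c; -(y * a), u] := by
  constructor
  · rintro ⟨hu, h⟩
    have hdet : g.det = g 0 0 * g 1 1 - g 0 1 * g 1 0 := Matrix.det_fin_two g
    have h' : gᵀ * Smat p a b c = Smat p a b c * g.adjugate := by
      have h2 := congrArg (fun M => M * g.adjugate) h
      simp only [Matrix.mul_assoc, Matrix.mul_adjugate, Matrix.smul_mul, Matrix.mul_smul,
        Matrix.mul_one] at h2
      exact smul_right_injective _ hu.ne_zero h2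
    have e00 := congrFun (congrFun h' 0) 0
    have e01 := congrFun (congrFun h' 0) 1
    simp [Smat, Matrix.mul_apply, Matrix.adjugate_fin_two] at e00 e01
    have e1 : g 0 0 = g 1 1 + (-g 1 0 / a) * b := by
      field_simp; linear_combination e00
    have e2 : g 0 1 = (-g 1 0 / a) * c := by
      field_simp; linear_combination e01
    refine ⟨g 1 1, -g 1 0 / a, ?_, ?_⟩
    · rw [hdet] at hu
      convert hu.ne_zero using 1
      rw [e1, e2, torusNorm]; field_simp; ring
    · ext i j; fin_cases i <;> fin_cases j <;> simp
      · exact e1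
      · exact e2
      · field_simp
  · rintro ⟨u, y, hN, rfl⟩
    refine ⟨?_, ?_⟩
    · rw [isUnit_iff_ne_zero, Matrix.det_fin_two]
      convert hN using 1
      simp [torusNorm]; ring
    · ext i j; fin_cases i <;> fin_cases j <;>
        simp [Smat, Matrix.det_fin_two, Matrix.mul_apply] <;> ring

lemma hmat_eq (l : ℤ) (m : ℕ) : hmat p l m =
    !![(p : ℚ_[p]) ^ m * (p : ℚ_[p]) ^ m * (p : ℚ_[p]) ^ l, 0, 0, 0;
      0, (p : ℚ_[p]) ^ m * (p : ℚ_[p]) ^ l, 0, 0; 0, 0, 1, 0; 0, 0, 0, (p : ℚ_[p]) ^ m] := by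
  have hp : (p : ℚ_[p]) ≠ 0 := by exact_mod_cast (Fact.out : p.Prime).ne_zero
  have h2 : (p : ℚ_[p]) ^ (2 * (m : ℤ) + l) =
      (p : ℚ_[p]) ^ m * (p : ℚ_[p]) ^ m * (p : ℚ_[p]) ^ l := by
    rw [two_mul, zpow_add₀ hp, zpow_add₀ hp, zpow_natCast]
  have h1 : (p : ℚ_[p]) ^ ((m : ℤ) + l) = (p : ℚ_[p]) ^ m * (p : ℚ_[p]) ^ l := by
    rw [zpow_add₀ hp, zpow_natCast]
  ext i j; fin_cases i <;> fin_cases j <;> simp [hmat, h1, h2]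

lemma isUnit_hmat (l : ℤ) (m : ℕ) : IsUnit (hmat p l m) := by
  have hp : (p : ℚ_[p]) ≠ 0 := by exact_mod_cast (Fact.out : p.Prime).ne_zero
  rw [Matrix.isUnit_iff_isUnit_det, isUnit_iff_ne_zero, hmat, Matrix.det_diagonal]
  simp only [Fin.prod_univ_four]
  simp [zpow_ne_zero _ hp, hp]

variable {a b c} in
lemma exists_isBessel_of_mem_Rgrp (ha : a ≠ 0) (l : ℤ) (m : ℕ)
    {r : Matrix (Fin 4) (Fin 4) ℚ_[p]} (hr : r ∈ Rgrp p a b c) :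
    ∃ g, IsBessel a b c ((p : ℚ_[p]) ^ m) g ∧ r * hmat p l m = hmat p l m * g := by
  have hp : (p : ℚ_[p]) ≠ 0 := by exact_mod_cast (Fact.out : p.Prime).ne_zero
  obtain ⟨t, ht, _, ⟨X, hX, rfl⟩, rfl⟩ := hr
  rw [emb_eq p ht.1, blk_eq]
  obtain ⟨u, y, hN, rfl⟩ := (mem_Tgrp_iff p ha).1 ht
  have hX' : X 1 0 = X 0 1 := congrFun (congrFun hX 0) 1
  have hm : (p : ℚ_[p]) ^ m ≠ 0 := pow_ne_zero _ hp
  have hl : (p : ℚ_[p]) ^ l ≠ 0 := zpow_ne_zero _ hp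
  rw [hmat_eq]
  generalize (p : ℚ_[p]) ^ m = e at *
  generalize (p : ℚ_[p]) ^ l = d at *
  refine ⟨_, ⟨u, y / e, X 0 0 / (e ^ 2 * d), X 0 1 / (e * d), X 1 1 / d, ?_, rfl⟩, ?_⟩
  · convert hN using 1
    unfold torusNorm; field_simp
  · ext i j; fin_cases i <;> fin_cases j <;> simp [torus, siegelU, hX'] <;> field_simp

variable {a b c} in
lemma exists_mem_Rgrp_of_isBessel (ha : a ≠ 0) (l : ℤ) (m : ℕ)
    {g : Matrix (Fin 4) (Fin 4) ℚ_[p]} (hg : IsBessel a b c ((p : ℚ_[p]) ^ m) g) :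
    ∃ r ∈ Rgrp p a b c, r * hmat p l m = hmat p l m * g := by
  have hp : (p : ℚ_[p]) ≠ 0 := by exact_mod_cast (Fact.out : p.Prime).ne_zero
  obtain ⟨u, y, n, q, r, hN, rfl⟩ := hg
  rw [hmat_eq]
  generalize (p : ℚ_[p]) ^ m = e at *
  generalize (p : ℚ_[p]) ^ l = d at *
  have ht : !![u + (e * y) * b, (e * y) * c; -((e * y) * a), u] ∈ Tgrp p a b c := by
    refine (mem_Tgrp_iff p ha).2 ⟨u, e * y, ?_, rfl⟩
    convert hN using 1
    unfold torusNorm; ring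
  refine ⟨_, ⟨_, ht, _, ⟨!![e ^ 2 * d * n, e * d * q; e * d * q, d * r], ?_, rfl⟩, rfl⟩, ?_⟩
  · ext i j; fin_cases i <;> fin_cases j <;> simp
  · rw [emb_eq p ht.1, blk_eq]
    ext i j; fin_cases i <;> fin_cases j <;> simp [torus, siegelU] <;> ring

section Reduction

open IsLocalRing

lemma residue_eq_zero_iff_norm_lt_one (x : ℤ_[p]) : residue ℤ_[p] x = 0 ↔ ‖x‖ < 1 := by
  rw [residue_eq_zero_iff, mem_maximalIdeal, PadicInt.mem_nonunits]

lemma exists_integral_of_mem_Kp {g : Matrix (Fin 4) (Fin 4) ℚ_[p]} (hg : g ∈ Kp p) :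
    ∃ (κ : Matrix (Fin 4) (Fin 4) ℤ_[p]) (μ : ℤ_[p]), IsUnit μ ∧ IsSim κ μ ∧
      κ.map PadicInt.Coe.ringHom = g := by
  obtain ⟨⟨-, μ, hμ⟩, hint, hdet⟩ := hg
  have hsim : IsSim g (μ : ℚ_[p]) := hμ
  have hμ1 : ‖(μ : ℚ_[p])‖ = 1 := by
    have h4 := congrArg norm hsim.det_sq
    rw [norm_pow, norm_pow, hdet, one_pow] at h4
    exact (pow_eq_one_iff_of_nonneg (norm_nonneg _) (by norm_num)).1 h4.symm
  obtain ⟨κ, hmap⟩ : ∃ κ : Matrix (Fin 4) (Fin 4) ℤ_[p], κ.map PadicInt.Coe.ringHom = g :=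
    ⟨Matrix.of fun i j => ⟨g i j, hint i j⟩, rfl⟩
  obtain ⟨ν, hν⟩ : ∃ ν : ℤ_[p], PadicInt.Coe.ringHom ν = (μ : ℚ_[p]) := ⟨⟨μ, hμ1.le⟩, rfl⟩
  refine ⟨κ, ν, PadicInt.isUnit_iff.2 ?_, ?_, hmap⟩
  · rw [← hμ1, ← hν]
    rfl
  have hinj : Function.Injective (PadicInt.Coe.ringHom : ℤ_[p] →+* ℚ_[p]) :=
    Subtype.val_injective
  apply Matrix.map_injective hinj
  dsimp only
  rw [Matrix.map_mul, Matrix.map_mul, map_sympJ, Matrix.transpose_map, hmap,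
    Matrix.map_smul' _ _ _ (map_mul _), map_sympJ, hν]
  exact hsim

lemma map_mem_Kp {κ : Matrix (Fin 4) (Fin 4) ℤ_[p]} {μ : ℤ_[p]} (hμ : IsUnit μ)
    (h : IsSim κ μ) : κ.map PadicInt.Coe.ringHom ∈ Kp p := by
  have hd : IsUnit κ.det := by
    rw [← isUnit_pow_iff two_ne_zero, h.det_sq]
    exact hμ.pow 4
  have hdet : (κ.map PadicInt.Coe.ringHom).det = ((κ.det : ℤ_[p]) : ℚ_[p]) :=
    (RingHom.map_det PadicInt.Coe.ringHom κ).symm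
  refine ⟨⟨?_, (hμ.map PadicInt.Coe.ringHom).unit, h.map PadicInt.Coe.ringHom⟩,
    fun i j => PadicInt.norm_le_one _, ?_⟩
  · rw [hdet]
    exact hd.map PadicInt.Coe.ringHom
  · rw [hdet]
    exact PadicInt.isUnit_iff.1 hd

lemma iwahoriShape_residue_iff (κ : Matrix (Fin 4) (Fin 4) ℤ_[p]) :
    IwahoriShape (κ.map (residue ℤ_[p])) ↔ ‖κ 0 1‖ < 1 ∧ ‖κ 2 0‖ < 1 ∧ ‖κ 2 1‖ < 1 ∧
      ‖κ 3 0‖ < 1 ∧ ‖κ 3 1‖ < 1 ∧ ‖κ 3 2‖ < 1 := by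
  simp only [IwahoriShape, Matrix.map_apply, residue_eq_zero_iff_norm_lt_one]

lemma exists_integral_of_mem_Ip {g : Matrix (Fin 4) (Fin 4) ℚ_[p]} (hg : g ∈ Ip p) :
    ∃ (κ : Matrix (Fin 4) (Fin 4) ℤ_[p]) (μ : ℤ_[p]), IsUnit μ ∧ IsSim κ μ ∧
      IwahoriShape (κ.map (residue ℤ_[p])) ∧ κ.map PadicInt.Coe.ringHom = g := by
  obtain ⟨hK, hI⟩ := hg
  obtain ⟨κ, μ, hμ, h, rfl⟩ := exists_integral_of_mem_Kp p hK
  exact ⟨κ, μ, hμ, h, (iwahoriShape_residue_iff p κ).2 hI, rfl⟩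

lemma map_mem_Ip {κ : Matrix (Fin 4) (Fin 4) ℤ_[p]} {μ : ℤ_[p]} (hμ : IsUnit μ)
    (h : IsSim κ μ) (hI : IwahoriShape (κ.map (residue ℤ_[p]))) :
    κ.map PadicInt.Coe.ringHom ∈ Ip p :=
  ⟨map_mem_Kp p hμ h, (iwahoriShape_residue_iff p κ).1 hI⟩

/-- The quotient of two elements of the Iwahori subgroup is again of that form. -/
lemma exists_integral_mul_inv {g g' : Matrix (Fin 4) (Fin 4) ℚ_[p]} (hg : g ∈ Ip p)
    (hg' : g' ∈ Ip p) :
    ∃ (κ : Matrix (Fin 4) (Fin 4) ℤ_[p]) (μ : ℤ_[p]), IsUnit μ ∧ IsSim κ μ ∧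
      IwahoriShape (κ.map (residue ℤ_[p])) ∧ κ.map PadicInt.Coe.ringHom * g = g' := by
  obtain ⟨κ, μ, hμ, h, hI, rfl⟩ := exists_integral_of_mem_Ip p hg
  obtain ⟨κ', μ', hμ', h', hI', rfl⟩ := exists_integral_of_mem_Ip p hg'
  obtain ⟨v, rfl⟩ := hμ
  have hadj : ((symAdj κ).map (residue ℤ_[p])) = symAdj (κ.map (residue ℤ_[p])) := by
    unfold symAdj
    rw [← map_sympJ (residue ℤ_[p]), ← Matrix.transpose_map, ← Matrix.map_mul, ← Matrix.map_mul]
    ext i j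
    simp only [Matrix.map_apply, Matrix.neg_apply, map_neg]
  have hsm : IsSim ((↑v⁻¹ : ℤ_[p]) • symAdj κ) (↑v⁻¹ : ℤ_[p]) := by
    have h1 := h.symAdj v.isUnit
    unfold IsSim at *
    rw [Matrix.transpose_smul, Matrix.smul_mul, Matrix.smul_mul, Matrix.mul_smul, h1, smul_smul,
      smul_smul]
    simp
  refine ⟨κ' * ((↑v⁻¹ : ℤ_[p]) • symAdj κ), μ' * ↑v⁻¹, hμ'.mul v⁻¹.isUnit, h'.mul hsm, ?_, ?_⟩
  · rw [Matrix.map_mul, Matrix.map_smul' _ _ _ (map_mul _), hadj]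
    exact hI'.mul (hI.symAdj.smul _)
  · rw [← Matrix.map_mul, Matrix.mul_assoc, Matrix.smul_mul, h.symAdj_mul, smul_smul]
    simp

/-- If the discriminant of a binary quadratic form over `ℤ_p` is a unit but not a square,
then the form is anisotropic over the residue field. -/
lemma residue_anisotropic {α β γ : ℤ_[p]} (hα : IsUnit α)
    (hd : IsUnit (β ^ 2 - 4 * α * γ)) (hnsq : ∀ z : ℤ_[p], z ^ 2 ≠ β ^ 2 - 4 * α * γ)
    (x y : ResidueField ℤ_[p])
    (hxy : residue ℤ_[p] α * x ^ 2 + residue ℤ_[p] β * x * y + residue ℤ_[p] γ * y ^ 2 = 0) :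
    x = 0 ∧ y = 0 := by
  have hα0 : residue ℤ_[p] α ≠ 0 := (residue_ne_zero_iff_isUnit α).2 hα
  by_cases hy : y = 0
  · subst hy
    simpa [hα0] using hxy
  exfalso
  obtain ⟨z₀, hz₀⟩ := residue_surjective (R := ℤ_[p]) (residue ℤ_[p] α * x / y)
  have hr : residue ℤ_[p] (z₀ ^ 2 + β * z₀ + α * γ) = 0 := by
    simp only [map_add, map_mul, map_pow, hz₀]
    field_simp
    linear_combination (residue ℤ_[p] α) * hxy
  have hu : IsUnit (2 * z₀ + β) := by
    rw [← isUnit_pow_iff two_ne_zero, ← residue_ne_zero_iff_isUnit,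
      show (2 * z₀ + β) ^ 2 = (β ^ 2 - 4 * α * γ) + 4 * (z₀ ^ 2 + β * z₀ + α * γ) by ring,
      map_add, map_mul, hr, mul_zero, add_zero, residue_ne_zero_iff_isUnit]
    exact hd
  let f : Polynomial ℤ_[p] :=
    Polynomial.X ^ 2 + Polynomial.C β * Polynomial.X + Polynomial.C (α * γ)
  have hf : ∀ z : ℤ_[p], f.aeval z = z ^ 2 + β * z + α * γ := by intro z; simp [f]
  have hf' : f.derivative.aeval z₀ = 2 * z₀ + β := by
    simp [f, Polynomial.derivative_pow]
  obtain ⟨z, hz, -⟩ := hensels_lemma (F := f) (a := z₀) (by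
    rw [hf, hf', PadicInt.isUnit_iff.1 hu, one_pow]
    exact (residue_eq_zero_iff_norm_lt_one p _).1 hr)
  rw [hf] at hz
  exact hnsq (2 * z + β) (by linear_combination 4 * hz)

/-- The reductions modulo `p` of integral elements meet one of the cells prescribed by `m`. -/
lemma exists_integral_cell {α β γ : ℤ_[p]} (hγ : IsUnit γ)
    (hS : ∀ x y : ResidueField ℤ_[p], residue ℤ_[p] α * x ^ 2 + residue ℤ_[p] β * x * y +
      residue ℤ_[p] γ * y ^ 2 = 0 → x = 0 ∧ y = 0)
    (m : ℕ) {κ : Matrix (Fin 4) (Fin 4) ℤ_[p]} {μ : ℤ_[p]} (hμ : IsUnit μ) (h : IsSim κ μ) :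
    ∃ j : Fin 8, (m = 0 → j ∈ ({0, 1, 4, 6} : Set (Fin 8))) ∧ ∃ u y n q r : ℤ_[p],
      IsUnit (torusNorm α β γ ((p : ℤ_[p]) ^ m) u y) ∧
      IwahoriShape ((cellRepInv ℤ_[p] j * (siegelU n q r *
        (torus α β γ ((p : ℤ_[p]) ^ m) u y * κ))).map (residue ℤ_[p])) := by
  have hsurj := residue_surjective (R := ℤ_[p])
  set ρ := residue ℤ_[p] with hρ
  have hμ0 : ρ μ ≠ 0 := (residue_ne_zero_iff_isUnit μ).2 hμ
  have hκ := h.map ρ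
  have H : ∃ j : Fin 8, (m = 0 → j ∈ ({0, 1, 4, 6} : Set (Fin 8))) ∧
      ∃ u y : ResidueField ℤ_[p],
        torusNorm (ρ α) (ρ β) (ρ γ) (ρ ((p : ℤ_[p]) ^ m)) u y ≠ 0 ∧
        CellCond (torus (ρ α) (ρ β) (ρ γ) (ρ ((p : ℤ_[p]) ^ m)) u y * κ.map ρ) j := by
    rcases eq_or_ne m 0 with rfl | hm
    · obtain ⟨j, hj, u, y, hN, hc⟩ := exists_torus_cellCond_one hS hκ hμ0
      exact ⟨j, fun _ => hj, u, y, by simpa using hN, by simpa using hc⟩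
    · have hp : ρ ((p : ℤ_[p]) ^ m) = 0 := by
        rw [map_pow, (residue_eq_zero_iff_norm_lt_one p _).2
          (PadicInt.mem_nonunits.1 PadicInt.p_nonunit), zero_pow hm]
      have hγ0 : ρ γ ≠ 0 := (residue_ne_zero_iff_isUnit γ).2 hγ
      rw [hp]
      obtain ⟨j, u, y, hN, hc⟩ :=
        exists_torus_cellCond_zero (a := ρ α) (b := ρ β) hγ0 (κ.map ρ)
      exact ⟨j, fun h0 => absurd h0 hm, u, y, hN, hc⟩
  obtain ⟨j, hj, u, y, hN, hc⟩ := H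
  obtain ⟨n, q, r, hI⟩ :=
    exists_unipotent_iwahori ((isSim_torus _ _ _ _ u y).mul hκ) (mul_ne_zero hN hμ0) j hc
  obtain ⟨u, rfl⟩ := hsurj u
  obtain ⟨y, rfl⟩ := hsurj y
  obtain ⟨n, rfl⟩ := hsurj n
  obtain ⟨q, rfl⟩ := hsurj q
  obtain ⟨r, rfl⟩ := hsurj r
  refine ⟨j, hj, u, y, n, q, r, ?_, ?_⟩
  · rw [← residue_ne_zero_iff_isUnit]
    simpa [torusNorm] using hN
  · rw [Matrix.map_mul, Matrix.map_mul, Matrix.map_mul, map_cellRepInv, map_siegelU, map_torus]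
    exact hI

end Reduction

lemma Jmat_mul_Umat_mul_Jmat (n q r : ℚ_[p]) :
    Jmat p * Umat p n q r * Jmat p = !![-1, 0, 0, 0; 0, -1, 0, 0; n, q, -1, 0; q, r, 0, -1] := by
  ext i j
  fin_cases i <;> fin_cases j <;> simp [Jmat, Umat, Matrix.mul_apply, Fin.sum_univ_four]

lemma Umat_mul_Jmat (n q r : ℚ_[p]) :
    Umat p n q r * Jmat p = !![-n, -q, 1, 0; -q, -r, 0, 1; -1, 0, 0, 0; 0, -1, 0, 0] := by
  ext i j
  fin_cases i <;> fin_cases j <;> simp [Jmat, Umat, Matrix.mul_apply, Fin.sum_univ_four]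

lemma t1_eq : t1 p = cellRep ℚ_[p] 0 := by
  rw [t1, Jmat_mul_Umat_mul_Jmat]
  ext i j
  fin_cases i <;> fin_cases j <;> simp [Zmat, cellRep, Matrix.mul_apply, Fin.sum_univ_four]

lemma t2_eq : t2 p = cellRep ℚ_[p] 1 := by
  rw [t2, Jmat_mul_Umat_mul_Jmat]
  ext i j
  fin_cases i <;> fin_cases j <;> simp [Zinf, cellRep, Matrix.mul_apply, Fin.sum_univ_four]

lemma t3_eq : t3 p = cellRep ℚ_[p] 2 := by
  rw [t3, Jmat_mul_Umat_mul_Jmat]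
  ext i j
  fin_cases i <;> fin_cases j <;> simp [Zmat, cellRep, Matrix.mul_apply, Fin.sum_univ_four]

lemma t4_eq : t4 p = cellRep ℚ_[p] 3 := by
  rw [t4, Jmat_mul_Umat_mul_Jmat]
  ext i j
  fin_cases i <;> fin_cases j <;> simp [Zinf, cellRep, Matrix.mul_apply, Fin.sum_univ_four]

lemma t5_eq : t5 p = cellRep ℚ_[p] 4 := by
  rw [t5, Jmat_mul_Umat_mul_Jmat]
  ext i j
  fin_cases i <;> fin_cases j <;> simp [Zmat, cellRep, Matrix.mul_apply, Fin.sum_univ_four]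

lemma t6_eq : t6 p = cellRep ℚ_[p] 5 := by
  rw [t6, Jmat_mul_Umat_mul_Jmat]
  ext i j
  fin_cases i <;> fin_cases j <;> simp [Zinf, cellRep, Matrix.mul_apply, Fin.sum_univ_four]

lemma t7_eq : t7 p = cellRep ℚ_[p] 6 := by
  rw [t7, Umat_mul_Jmat]
  ext i j
  fin_cases i <;> fin_cases j <;> simp [Zmat, cellRep, Matrix.mul_apply, Fin.sum_univ_four]

lemma t8_eq : t8 p = cellRep ℚ_[p] 7 := by
  rw [t8, Umat_mul_Jmat]
  ext i j
  fin_cases i <;> fin_cases j <;> simp [Zinf, cellRep, Matrix.mul_apply, Fin.sum_univ_four]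

lemma mem_TsetM_iff (m : ℕ) (t : Matrix (Fin 4) (Fin 4) ℚ_[p]) :
    t ∈ TsetM p m ↔ ∃ j : Fin 8, (m = 0 → j ∈ ({0, 1, 4, 6} : Set (Fin 8))) ∧
      t = cellRep ℚ_[p] j := by
  unfold TsetM
  rw [t1_eq, t2_eq, t3_eq, t4_eq, t5_eq, t6_eq, t7_eq, t8_eq]
  rcases eq_or_ne m 0 with rfl | hm
  · simp
  · simp only [hm, if_false, false_implies, true_and, Set.mem_insert_iff, Set.mem_singleton_iff]
    constructor
    · rintro (h | h | h | h | h | h | h | h) <;> exact ⟨_, h⟩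
    · rintro ⟨j, rfl⟩
      fin_cases j <;> simp

lemma exists_mem_cell {α β γ : ℤ_[p]} (hα : IsUnit α) (hγ : IsUnit γ)
    (hS : ∀ x y : IsLocalRing.ResidueField ℤ_[p], IsLocalRing.residue ℤ_[p] α * x ^ 2 +
      IsLocalRing.residue ℤ_[p] β * x * y + IsLocalRing.residue ℤ_[p] γ * y ^ 2 = 0 →
        x = 0 ∧ y = 0)
    (l : ℤ) (m : ℕ) {r k : Matrix (Fin 4) (Fin 4) ℚ_[p]} (hr : r ∈ Rgrp p (α : ℚ_[p]) β γ)
    (hk : k ∈ Kp p) :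
    ∃ t ∈ TsetM p m, ∃ r' ∈ Rgrp p (α : ℚ_[p]) β γ, ∃ i ∈ Ip p,
      r * hmat p l m * k = r' * hmat p l m * t * i := by
  have hφ : ∀ x : ℤ_[p], PadicInt.Coe.ringHom x = (x : ℚ_[p]) := fun _ => rfl
  have hα0 : (α : ℚ_[p]) ≠ 0 := (hα.map PadicInt.Coe.ringHom).ne_zero
  obtain ⟨κ, μ, hμ, hκ, rfl⟩ := exists_integral_of_mem_Kp p hk
  obtain ⟨j, hj, u, y, n, q, s, hN, hI⟩ := exists_integral_cell p hγ hS m hμ hκ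
  obtain ⟨π, hπ, hrπ⟩ := exists_isBessel_of_mem_Rgrp p hα0 l m hr
  have hτ : IsBessel (α : ℚ_[p]) β γ ((p : ℚ_[p]) ^ m)
      (siegelU (n : ℚ_[p]) q s * torus (α : ℚ_[p]) β γ ((p : ℚ_[p]) ^ m) u y) := by
    refine (isBessel_siegelU ..).mul (isBessel_torus ?_)
    have := (hN.map PadicInt.Coe.ringHom).ne_zero
    simpa [torusNorm, hφ] using this
  obtain ⟨σ, hσ, hστ⟩ := hτ.exists_inv
  obtain ⟨r', hr', hr'π⟩ := exists_mem_Rgrp_of_isBessel p hα0 l m (hπ.mul hσ)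
  refine ⟨cellRep ℚ_[p] j, (mem_TsetM_iff p m _).2 ⟨j, hj, rfl⟩, r', hr', _,
    map_mem_Ip p ?_ ((isSim_cellRepInv j).mul ((isSim_siegelU n q s).mul
      ((isSim_torus _ _ _ _ u y).mul hκ))) hI, ?_⟩
  · simpa using hN.mul hμ
  · have hU : (siegelU n q s).map PadicInt.Coe.ringHom = siegelU (n : ℚ_[p]) q s :=
      map_siegelU _ _ _ _
    have hT : (torus α β γ ((p : ℤ_[p]) ^ m) u y).map PadicInt.Coe.ringHom =
        torus (α : ℚ_[p]) β γ ((p : ℚ_[p]) ^ m) u y := by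
      rw [map_torus]; simp [hφ]
    rw [Matrix.map_mul, Matrix.map_mul, Matrix.map_mul, map_cellRepInv, hU, hT, hrπ, hr'π]
    calc hmat p l m * π * κ.map PadicInt.Coe.ringHom
        = hmat p l m * π * (σ * (siegelU (n : ℚ_[p]) q s *
            torus (α : ℚ_[p]) β γ ((p : ℚ_[p]) ^ m) u y)) * κ.map PadicInt.Coe.ringHom := by
          rw [hστ, Matrix.mul_one]
      _ = hmat p l m * (π * σ) * (cellRep ℚ_[p] j * cellRepInv ℚ_[p] j) *
            (siegelU (n : ℚ_[p]) q s * (torus (α : ℚ_[p]) β γ ((p : ℚ_[p]) ^ m) u y *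
              κ.map PadicInt.Coe.ringHom)) := by
          rw [cellRep_mul_cellRepInv, Matrix.mul_one]
          simp only [Matrix.mul_assoc]
      _ = _ := by simp only [Matrix.mul_assoc]

lemma cell_unique {α β γ : ℤ_[p]} (hα : IsUnit α) (hγ : IsUnit γ) (l : ℤ) (m : ℕ)
    {t t' r r' i i' : Matrix (Fin 4) (Fin 4) ℚ_[p]} (ht : t ∈ TsetM p m) (ht' : t' ∈ TsetM p m)
    (hr : r ∈ Rgrp p (α : ℚ_[p]) β γ) (hr' : r' ∈ Rgrp p (α : ℚ_[p]) β γ)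
    (hi : i ∈ Ip p) (hi' : i' ∈ Ip p)
    (h : r * hmat p l m * t * i = r' * hmat p l m * t' * i') : t = t' := by
  have hφ : ∀ x : ℤ_[p], PadicInt.Coe.ringHom x = (x : ℚ_[p]) := fun _ => rfl
  have hα0 : (α : ℚ_[p]) ≠ 0 := (hα.map PadicInt.Coe.ringHom).ne_zero
  obtain ⟨j, hj, rfl⟩ := (mem_TsetM_iff p m t).1 ht
  obtain ⟨k, hk, rfl⟩ := (mem_TsetM_iff p m t').1 ht'
  obtain ⟨π, hπ, hrπ⟩ := exists_isBessel_of_mem_Rgrp p hα0 l m hr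
  obtain ⟨π', hπ', hrπ'⟩ := exists_isBessel_of_mem_Rgrp p hα0 l m hr'
  obtain ⟨σ, hσ, hσπ'⟩ := hπ'.exists_inv
  obtain ⟨κ, μ, hμ, hκ, hI, rfl⟩ := exists_integral_mul_inv p hi hi'
  have hiu : IsUnit i := (Matrix.isUnit_iff_isUnit_det _).2 hi.1.1.1
  rw [hrπ, hrπ', ← Matrix.mul_assoc, hiu.mul_left_inj] at h
  simp only [Matrix.mul_assoc] at h
  rw [(isUnit_hmat p l m).mul_right_inj] at h
  set s : Matrix (Fin 4) (Fin 4) ℤ_[p] := cellRep ℤ_[p] k * κ * cellRepInv ℤ_[p] j with hs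
  have hsσ : s.map PadicInt.Coe.ringHom = σ * π := by
    rw [hs, Matrix.map_mul, Matrix.map_mul, map_cellRep, map_cellRepInv]
    calc cellRep ℚ_[p] k * κ.map PadicInt.Coe.ringHom * cellRepInv ℚ_[p] j
        = (σ * π') * (cellRep ℚ_[p] k * κ.map PadicInt.Coe.ringHom) * cellRepInv ℚ_[p] j := by
          rw [hσπ', Matrix.one_mul]
      _ = σ * (π' * (cellRep ℚ_[p] k * κ.map PadicInt.Coe.ringHom)) * cellRepInv ℚ_[p] j := by
          simp only [Matrix.mul_assoc]
      _ = σ * π * (cellRep ℚ_[p] j * cellRepInv ℚ_[p] j) := by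
          rw [← h]; simp only [Matrix.mul_assoc]
      _ = _ := by rw [cellRep_mul_cellRepInv, Matrix.mul_one]
  have hκs : κ = cellRepInv ℤ_[p] k * (s * cellRep ℤ_[p] j) := by
    rw [hs, Matrix.mul_assoc, cellRepInv_mul_cellRep, Matrix.mul_one, ← Matrix.mul_assoc,
      cellRepInv_mul_cellRep, Matrix.one_mul]
  have hsim : IsSim s (1 * μ * 1) := ((isSim_cellRep k).mul hκ).mul (isSim_cellRepInv j)
  rw [one_mul, mul_one] at hsim
  obtain ⟨e20, e21, e30, e31, e10⟩ := (hσ.mul hπ).entries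
  rw [← hsσ] at e20 e21 e30 e31 e10
  simp only [Matrix.map_apply] at e20 e21 e30 e31 e10
  have hinj : Function.Injective (PadicInt.Coe.ringHom : ℤ_[p] →+* ℚ_[p]) :=
    Subtype.val_injective
  rw [map_eq_zero_iff _ hinj] at e20 e21 e30 e31
  have e10' : γ * s 1 0 = -(α * ((p : ℤ_[p]) ^ m) ^ 2 * s 0 1) := by
    apply hinj
    simpa [hφ] using e10
  set ρ := IsLocalRing.residue ℤ_[p] with hρ
  rw [hκs, Matrix.map_mul, Matrix.map_mul, map_cellRep, map_cellRepInv] at hI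
  have hμ0 : ρ μ ≠ 0 := (IsLocalRing.residue_ne_zero_iff_isUnit μ).2 hμ
  have z : ∀ {x : ℤ_[p]}, x = 0 → ρ x = 0 := fun hx => by rw [hx, map_zero]
  congr 1
  rcases eq_or_ne m 0 with hm | hm
  · exact cell_disjoint_one (hsim.map ρ) hμ0 (z e20) (z e21) (z e30) (z e31) (hj hm) (hk hm) hI
  · refine cell_disjoint_zero (hsim.map ρ) hμ0 (z e20) (z e21) (z e30) (z e31) ?_ j k hI
    have hγ0 : ρ γ ≠ 0 := (IsLocalRing.residue_ne_zero_iff_isUnit γ).2 hγ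
    have hp : ρ (p : ℤ_[p]) = 0 :=
      (residue_eq_zero_iff_norm_lt_one p _).2 (PadicInt.mem_nonunits.1 PadicInt.p_nonunit)
    have := congrArg ρ e10'
    simpa [-map_natCast, hp, hm, hγ0] using this

theorem double_coset_decomposition
    (ha : ‖a‖ = 1) (hb : ‖b‖ ≤ 1) (hc : ‖c‖ = 1)
    (hd : ‖b ^ 2 - 4 * a * c‖ = 1)
    (hnsq : ∀ z : ℚ_[p], z ^ 2 ≠ b ^ 2 - 4 * a * c)
    (l : ℤ) (m : ℕ) :
    ∀ g : Matrix (Fin 4) (Fin 4) ℚ_[p],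
      (∃ r ∈ Rgrp p a b c, ∃ k ∈ Kp p, g = r * hmat p l m * k) →
      ∃! t, t ∈ TsetM p m ∧ ∃ r ∈ Rgrp p a b c, ∃ k ∈ Ip p,
        g = r * hmat p l m * t * k := by
  have ha0 : a ≠ 0 := norm_ne_zero_iff.1 (by simp [ha])
  have hc0 : c ≠ 0 := norm_ne_zero_iff.1 (by simp [hc])
  obtain ⟨α, rfl⟩ : ∃ α : ℤ_[p], (α : ℚ_[p]) = a := ⟨⟨a, ha.le⟩, rfl⟩
  obtain ⟨β, rfl⟩ : ∃ β : ℤ_[p], (β : ℚ_[p]) = b := ⟨⟨b, hb⟩, rfl⟩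
  obtain ⟨γ, rfl⟩ : ∃ γ : ℤ_[p], (γ : ℚ_[p]) = c := ⟨⟨c, hc.le⟩, rfl⟩
  have hα : IsUnit α := PadicInt.isUnit_iff.2 ha
  have hγ : IsUnit γ := PadicInt.isUnit_iff.2 hc
  have hS := residue_anisotropic p (β := β) (γ := γ) hα (PadicInt.isUnit_iff.2 (by
    rw [← hd, PadicInt.norm_def]; push_cast; rfl)) (fun z hz => hnsq z (by
    rw [← PadicInt.coe_pow, hz]; push_cast; rfl))
  rintro g ⟨r, hr, k, hk, rfl⟩
  obtain ⟨t, ht, htI⟩ := exists_mem_cell p hα hγ hS l m hr hk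
  refine ⟨t, ⟨ht, htI⟩, ?_⟩
  rintro t' ⟨ht', r', hr', i', hi', h'⟩
  obtain ⟨r'', hr'', i'', hi'', h''⟩ := htI
  exact cell_unique p hα hγ l m ht' ht hr' hr'' hi' hi'' (h'.symm.trans h'')
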